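/- For every f ∈ W and every (T,x) ∈ D, one has −(Af)_T(T,x) > 0, i.e., the partial derivative of Af with respect to T is strictly negative on D. -/

import Mathlib

open Set MeasureTheory Filter Topology

noncomputable section

/-- The context of the BCS-Bogoliubov model: the cutoff `eps`, the Debye energy `om = ℏω_D`,
the potential `U` with bounds `U₁ ≤ U ≤ U₂`, the constant `a`, the temperatures
`tau₁, tau₂, T₀, Tc`, the solutions `Δ₁, Δ₂` of the constant-potential gap equations,
the constant `Mz = max_{z ≥ 0} z / cosh z` and the constant `MT = M_T`. -/
structure BCSContext where
  eps : ℝ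
  om : ℝ
  U : ℝ → ℝ → ℝ
  U₁ : ℝ
  U₂ : ℝ
  Umax : ℝ
  Umin : ℝ
  a : ℝ
  tau₁ : ℝ
  tau₂ : ℝ
  Δ₁ : ℝ → ℝ
  Δ₂ : ℝ → ℝ
  Tc : ℝ
  T₀ : ℝ
  Mz : ℝ
  MT : ℝ
  heps : 0 < eps
  hepsom : eps < om
  hU₁pos : 0 < U₁
  hU₁₂ : U₁ ≤ U₂
  hUsmooth : ContDiffOn ℝ 2 (fun p : ℝ × ℝ => U p.1 p.2) (Icc eps om ×ˢ Icc eps om)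
  hUlb : ∀ x ∈ Icc eps om, ∀ ξ ∈ Icc eps om, U₁ ≤ U x ξ
  hUub : ∀ x ∈ Icc eps om, ∀ ξ ∈ Icc eps om, U x ξ ≤ U₂
  hUmax : IsGreatest (Set.image2 U (Icc eps om) (Icc eps om)) Umax
  hUmin : IsLeast (Set.image2 U (Icc eps om) (Icc eps om)) Umin
  ha : a = (Umax / Umin) ^ 2
  htau₁pos : 0 < tau₁
  htau₂pos : 0 < tau₂
  htau₁ : 1 = U₁ * (∫ ξ in eps..om, Real.tanh (ξ / (2 * tau₁)) / ξ)
  htau₂ : 1 = U₂ * (∫ ξ in eps..om, Real.tanh (ξ / (2 * tau₂)) / ξ)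
  hΔ₁nonneg : ∀ T, 0 ≤ Δ₁ T
  hΔ₂nonneg : ∀ T, 0 ≤ Δ₂ T
  hΔ₁cont : Continuous Δ₁
  hΔ₂cont : Continuous Δ₂
  hΔ₁anti : StrictAntiOn Δ₁ (Icc 0 tau₁)
  hΔ₂anti : StrictAntiOn Δ₂ (Icc 0 tau₂)
  hΔ₁eq : ∀ T ∈ Ioc 0 tau₁, U₁ * (∫ ξ in eps..om,
      Real.tanh (Real.sqrt (ξ ^ 2 + Δ₁ T ^ 2) / (2 * T)) / Real.sqrt (ξ ^ 2 + Δ₁ T ^ 2)) = 1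
  hΔ₂eq : ∀ T ∈ Ioc 0 tau₂, U₂ * (∫ ξ in eps..om,
      Real.tanh (Real.sqrt (ξ ^ 2 + Δ₂ T ^ 2) / (2 * T)) / Real.sqrt (ξ ^ 2 + Δ₂ T ^ 2)) = 1
  hΔ₁zero : ∀ T, tau₁ ≤ T → Δ₁ T = 0
  hΔ₂zero : ∀ T, tau₂ ≤ T → Δ₂ T = 0
  hTc₁ : tau₁ ≤ Tc
  hTc₂ : Tc ≤ tau₂
  hT₀₁ : tau₁ < T₀
  hT₀₂ : T₀ < Tc
  hMz : IsGreatest ((fun z => z / Real.cosh z) '' Set.Ici (0 : ℝ)) Mz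
  hMT : MT = 4 * a * U₂ * Mz ^ 2 /
      (eps * U₁ *
        (Real.tanh (eps / (2 * Tc)) - (eps / (2 * Tc)) / Real.cosh (eps / (2 * Tc)) ^ 2) *
        (∫ ξ in eps..om, (ξ ^ 2 + Δ₂ 0 ^ 2) ^ (-(3 : ℝ) / 2)))

namespace BCSContext

/-- The energy interval `I = [ε, ℏω_D]`. -/
def Iset (C : BCSContext) : Set ℝ := Icc C.eps C.om

/-- The rectangle `D = [T₀, T_c] × I`. -/
def Dset (C : BCSContext) : Set (ℝ × ℝ) := Icc C.T₀ C.Tc ×ˢ Icc C.eps C.om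

end BCSContext

/-- The operator `A` of the squared BCS-Bogoliubov gap equation. -/
def opA (C : BCSContext) (f : ℝ → ℝ → ℝ) (T x : ℝ) : ℝ :=
  (∫ ξ in C.eps..C.om, C.U x ξ * Real.sqrt (f T ξ / (ξ ^ 2 + f T ξ)) *
      Real.tanh (Real.sqrt (ξ ^ 2 + f T ξ) / (2 * T))) ^ 2

/-- Partial derivative with respect to the temperature `T` (within `[T₀, T_c]`). -/
def pderivT (C : BCSContext) (g : ℝ → ℝ → ℝ) (T x : ℝ) : ℝ :=
  derivWithin (fun s => g s x) (Icc C.T₀ C.Tc) T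

/-- Partial derivative with respect to the energy `x` (within `I = [ε, ℏω_D]`). -/
def pderivX (C : BCSContext) (g : ℝ → ℝ → ℝ) (T x : ℝ) : ℝ :=
  derivWithin (fun y => g T y) (Icc C.eps C.om) x

/-- Membership in the set `W`. -/
def memW (C : BCSContext) (f : ℝ → ℝ → ℝ) : Prop :=
  ContDiffOn ℝ 2 (fun p : ℝ × ℝ => f p.1 p.2) C.Dset ∧
  (∀ T ∈ Icc C.T₀ C.Tc, ∀ x ∈ C.Iset, C.Δ₁ T ^ 2 ≤ f T x ∧ f T x ≤ C.Δ₂ T ^ 2) ∧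
  (∀ x ∈ C.Iset, f C.Tc x = 0) ∧
  (∀ T ∈ Ico C.T₀ C.Tc, ∀ x ∈ C.Iset, ∀ x₁ ∈ C.Iset, f T x ≤ C.a * f T x₁) ∧
  (∀ x ∈ C.Iset, ∀ x₁ ∈ C.Iset,
      -(pderivT C f C.Tc x) ≤ C.a * -(pderivT C f C.Tc x₁)) ∧
  (∀ T ∈ Icc C.T₀ C.Tc, ∀ x ∈ C.Iset, pderivT C f T x < 0) ∧
  (∀ T ∈ Icc C.T₀ C.Tc, ∀ x ∈ C.Iset, -(pderivT C f T x) ≤ C.MT)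

/-- The condition `a^{1/4} · max_{(T,x) ∈ D} ∫_I (U(x,ξ)/ξ) tanh(ξ/(2T)) dξ ≤ 1`. -/
def gapCondition (C : BCSContext) : Prop :=
  ∀ T ∈ Icc C.T₀ C.Tc, ∀ x ∈ C.Iset,
    C.a ^ ((1 : ℝ) / 4) * (∫ ξ in C.eps..C.om, C.U x ξ / ξ * Real.tanh (ξ / (2 * T))) ≤ 1

instance (C : BCSContext) : CompactSpace ↥C.Dset :=
  isCompact_iff_compactSpace.mp (isCompact_Icc.prod isCompact_Icc)

-- Extension of a continuous function on `D` to a function on `ℝ × ℝ` (by `0` outside `D`).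
open Classical in
def extFun (C : BCSContext) (F : C(↥C.Dset, ℝ)) : ℝ → ℝ → ℝ :=
  fun T x => if h : (T, x) ∈ C.Dset then F ⟨(T, x), h⟩ else 0

/-- The set `W` regarded as a subset of the Banach space `C(D)`. -/
def WSet (C : BCSContext) : Set C(↥C.Dset, ℝ) :=
  {F | ∃ f : ℝ → ℝ → ℝ, memW C f ∧ ∀ p : ↥C.Dset, F p = f (p : ℝ × ℝ).1 (p : ℝ × ℝ).2}

section Auxiliary

variable {F : ℝ × ℝ → ℝ} {a b c d : ℝ}

lemma contDiff_tanh {n : WithTop ℕ∞} : ContDiff ℝ n Real.tanh := by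
  have h : Real.tanh = fun x => Real.sinh x / Real.cosh x := funext Real.tanh_eq_sinh_div_cosh
  rw [h]
  exact Real.contDiff_sinh.div Real.contDiff_cosh fun x => (Real.cosh_pos x).ne'

lemma hasDerivAt_tanh (x : ℝ) : HasDerivAt Real.tanh (1 / Real.cosh x ^ 2) x := by
  have h : Real.tanh = fun x => Real.sinh x / Real.cosh x := funext Real.tanh_eq_sinh_div_cosh
  rw [h]
  refine ((Real.hasDerivAt_sinh x).div (Real.hasDerivAt_cosh x)
    (Real.cosh_pos x).ne').congr_deriv ?_
  congr 1
  linarith [Real.cosh_sq x]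

lemma tanh_pos {x : ℝ} (hx : 0 < x) : 0 < Real.tanh x := by
  rw [Real.tanh_eq_sinh_div_cosh]
  exact div_pos (Real.sinh_pos_iff.2 hx) (Real.cosh_pos x)

lemma uniqueDiffOn_Icc_prod (hab : a < b) (hcd : c < d) :
    UniqueDiffOn ℝ (Icc a b ×ˢ Icc c d) :=
  (uniqueDiffOn_Icc hab).prod (uniqueDiffOn_Icc hcd)

lemma hasDerivWithinAt_partial_fst (hF : ContDiffOn ℝ 1 F (Icc a b ×ˢ Icc c d)) {t ξ : ℝ}
    (ht : t ∈ Icc a b) (hξ : ξ ∈ Icc c d) :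
    HasDerivWithinAt (fun s => F (s, ξ))
      (fderivWithin ℝ F (Icc a b ×ˢ Icc c d) (t, ξ) (1, 0)) (Icc a b) t := by
  have h := (hF.differentiableOn one_ne_zero (t, ξ) ⟨ht, hξ⟩).hasFDerivWithinAt
  have hmaps : MapsTo (fun s : ℝ => (s, ξ)) (Icc a b) (Icc a b ×ˢ Icc c d) :=
    fun s hs => ⟨hs, hξ⟩
  exact h.comp_hasDerivWithinAt t
    ((hasDerivWithinAt_id t _).prodMk (hasDerivWithinAt_const t _ ξ)) hmaps

lemma continuousOn_partial_fst (hab : a < b) (hcd : c < d)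
    (hF : ContDiffOn ℝ 1 F (Icc a b ×ˢ Icc c d)) :
    ContinuousOn (fun p => fderivWithin ℝ F (Icc a b ×ˢ Icc c d) p (1, 0))
      (Icc a b ×ˢ Icc c d) :=
  (hF.continuousOn_fderivWithin (uniqueDiffOn_Icc_prod hab hcd) le_rfl).clm_apply
    continuousOn_const

lemma ContinuousOn.section_snd {E : Type*} [TopologicalSpace E] {H : ℝ × ℝ → E} {s u : Set ℝ}
    (hH : ContinuousOn H (s ×ˢ u)) {t : ℝ} (ht : t ∈ s) : ContinuousOn (fun ξ => H (t, ξ)) u :=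
  hH.comp (by fun_prop) fun _ hξ => ⟨ht, hξ⟩

/-- Differentiation under the integral sign, including the endpoints of the parameter interval. -/
lemma hasDerivWithinAt_integral_mul (hab : a < b) (hcd : c < d) {V : ℝ → ℝ}
    (hV : ContinuousOn V (Icc c d)) (hF : ContDiffOn ℝ 1 F (Icc a b ×ˢ Icc c d)) {t : ℝ}
    (ht : t ∈ Icc a b) :
    HasDerivWithinAt (fun s => ∫ ξ in c..d, V ξ * F (s, ξ))
      (∫ ξ in c..d, V ξ * fderivWithin ℝ F (Icc a b ×ˢ Icc c d) (t, ξ) (1, 0)) (Icc a b) t := by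
  set F' : ℝ × ℝ → ℝ := fun p => fderivWithin ℝ F (Icc a b ×ˢ Icc c d) p (1, 0)
  obtain ⟨K, hK⟩ := (isCompact_Icc.prod isCompact_Icc).exists_bound_of_continuousOn
    (continuousOn_partial_fst hab hcd hF)
  obtain ⟨L, hL⟩ := isCompact_Icc.exists_bound_of_continuousOn hV
  have hcont : ∀ s ∈ Icc a b, ContinuousOn (fun ξ => V ξ * F (s, ξ)) (Icc c d) := fun s hs =>
    hV.mul (hF.continuousOn.section_snd hs)
  have hint : ∀ s ∈ Icc a b, IntervalIntegrable (fun ξ => V ξ * F (s, ξ)) volume c d := fun s hs =>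
    (hcont s hs).intervalIntegrable_of_Icc hcd.le
  have hmem : ∀ᶠ s in 𝓝[Icc a b \ {t}] t, s ∈ Icc a b \ {t} := self_mem_nhdsWithin
  have hsub : uIoc c d ⊆ Icc c d := by
    rw [uIoc_of_le hcd.le]; exact Ioc_subset_Icc_self
  rw [hasDerivWithinAt_iff_tendsto_slope]
  have key : Tendsto (fun s => ∫ ξ in c..d, V ξ * slope (fun r => F (r, ξ)) t s)
      (𝓝[Icc a b \ {t}] t) (𝓝 (∫ ξ in c..d, V ξ * F' (t, ξ))) := by
    refine intervalIntegral.tendsto_integral_filter_of_dominated_convergence (fun _ => L * K)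
      ?_ ?_ intervalIntegrable_const ?_
    · filter_upwards [hmem] with s hs
      refine ContinuousOn.aestronglyMeasurable (ContinuousOn.mono ?_ hsub) measurableSet_uIoc
      simp only [slope_def_field]
      exact hV.mul (((hF.continuousOn.section_snd hs.1).sub
        (hF.continuousOn.section_snd ht)).div_const _)
    · filter_upwards [hmem] with s hs
      refine Eventually.of_forall fun ξ hξ => ?_
      have hξ' := hsub hξ
      have h := (convex_Icc a b).norm_image_sub_le_of_norm_hasDerivWithin_le
        (f := fun r => F (r, ξ)) (f' := fun r => F' (r, ξ)) (C := K)
        (fun r hr => hasDerivWithinAt_partial_fst hF hr hξ') (fun r hr => hK (r, ξ) ⟨hr, hξ'⟩)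
        ht hs.1
      have hst : 0 < ‖s - t‖ := norm_pos_iff.2 (sub_ne_zero.2 hs.2)
      rw [norm_mul, slope_def_field, norm_div]
      exact mul_le_mul (hL ξ hξ') ((div_le_iff₀ hst).2 h) (by positivity)
        ((norm_nonneg _).trans (hL ξ hξ'))
    · refine Eventually.of_forall fun ξ hξ => ?_
      exact ((hasDerivWithinAt_iff_tendsto_slope.1
        (hasDerivWithinAt_partial_fst hF ht (hsub hξ)))).const_mul _
  refine key.congr' ?_
  filter_upwards [hmem] with s hs
  rw [slope_def_field, ← intervalIntegral.integral_sub (hint s hs.1) (hint t ht),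
    ← intervalIntegral.integral_div]
  congr 1
  ext ξ
  rw [slope_def_field]
  ring

end Auxiliary

/-- The integrand of the gap operator without the potential, at energy `ξ`, temperature `T` and
squared gap `y`. -/
def gapKernel (y T ξ : ℝ) : ℝ :=
  Real.sqrt (y / (ξ ^ 2 + y)) * Real.tanh (Real.sqrt (ξ ^ 2 + y) / (2 * T))

lemma gapKernel_deriv_neg {φ : ℝ → ℝ} {φ' t ξ : ℝ} {s : Set ℝ} (hs : UniqueDiffWithinAt ℝ s t)
    (hξ : 0 < ξ) (ht : 0 < t) (hφt : 0 < φ t) (hφ' : φ' < 0) (hφ : HasDerivWithinAt φ φ' s t)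
    {g' : ℝ} (hg : HasDerivWithinAt (fun r => gapKernel (φ r) r ξ) g' s t) : g' < 0 := by
  have hden : 0 < ξ ^ 2 + φ t := by positivity
  have h1 : HasDerivWithinAt (fun r => ξ ^ 2 + φ r) φ' s t := hφ.const_add _
  have h2 := (hφ.div h1 hden.ne').sqrt (div_pos hφt hden).ne'
  have h3 := (h1.sqrt hden.ne').div ((hasDerivWithinAt_id t s).const_mul 2)
    (by simpa using ht.ne')
  have h4 := (hasDerivAt_tanh _).comp_hasDerivWithinAt t h3
  have h5 := h2.mul h4
  rw [hs.eq_deriv _ hg h5]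
  have hS : 0 < Real.sqrt (ξ ^ 2 + φ t) := Real.sqrt_pos.2 hden
  have hQ : 0 < Real.sqrt (φ t / (ξ ^ 2 + φ t)) := Real.sqrt_pos.2 (div_pos hφt hden)
  have hth : 0 < Real.tanh (Real.sqrt (ξ ^ 2 + φ t) / (2 * t)) := by
    apply tanh_pos; positivity
  refine add_neg (mul_neg_of_neg_of_pos ?_ hth) (mul_neg_of_pos_of_neg hQ ?_)
  · refine div_neg_of_neg_of_pos (div_neg_of_neg_of_pos ?_ (by positivity)) (by positivity)
    nlinarith [mul_neg_of_pos_of_neg (pow_pos hξ 2) hφ']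
  · refine mul_neg_of_pos_of_neg (div_pos one_pos (pow_pos (Real.cosh_pos _) 2))
      (div_neg_of_neg_of_pos ?_ (by simp only [id]; positivity))
    have : φ' / (2 * Real.sqrt (ξ ^ 2 + φ t)) < 0 :=
      div_neg_of_neg_of_pos hφ' (by positivity)
    simp only [id]
    nlinarith

namespace BCSContext

variable {C : BCSContext} {f : ℝ → ℝ → ℝ}

lemma T₀_pos (C : BCSContext) : 0 < C.T₀ := C.htau₁pos.trans C.hT₀₁

lemma potential_continuousOn {x : ℝ} (hx : x ∈ C.Iset) :
    ContinuousOn (C.U x) (Icc C.eps C.om) :=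
  C.hUsmooth.continuousOn.section_snd hx

lemma potential_pos {x ξ : ℝ} (hx : x ∈ C.Iset) (hξ : ξ ∈ Icc C.eps C.om) : 0 < C.U x ξ :=
  C.hU₁pos.trans_le (C.hUlb x hx ξ hξ)

lemma opA_eq (C : BCSContext) (f : ℝ → ℝ → ℝ) (T x : ℝ) :
    opA C f T x = (∫ ξ in C.eps..C.om, C.U x ξ * gapKernel (f T ξ) T ξ) ^ 2 := by
  simp only [opA, gapKernel, mul_assoc]

lemma memW_hasDerivWithinAt (hf : memW C f) {T ξ : ℝ} (hT : T ∈ Icc C.T₀ C.Tc)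
    (hξ : ξ ∈ C.Iset) :
    HasDerivWithinAt (fun s => f s ξ) (pderivT C f T ξ) (Icc C.T₀ C.Tc) T :=
  (hasDerivWithinAt_partial_fst (hf.1.of_le one_le_two) hT
    hξ).differentiableWithinAt.hasDerivWithinAt

lemma continuousOn_pderivT (hf : memW C f) {T : ℝ} (hT : T ∈ Icc C.T₀ C.Tc) :
    ContinuousOn (pderivT C f T) (Icc C.eps C.om) := by
  have hC1 := hf.1.of_le one_le_two
  refine ((continuousOn_partial_fst C.hT₀₂ C.hepsom hC1).section_snd hT).congr fun ξ hξ => ?_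
  exact (hasDerivWithinAt_partial_fst hC1 hT hξ).derivWithin (uniqueDiffOn_Icc C.hT₀₂ T hT)

lemma memW_pos (hf : memW C f) {T ξ : ℝ} (hT : T ∈ Ico C.T₀ C.Tc) (hξ : ξ ∈ C.Iset) :
    0 < f T ξ := by
  have hanti : StrictAntiOn (fun s => f s ξ) (Icc C.T₀ C.Tc) := by
    refine strictAntiOn_of_deriv_neg (convex_Icc _ _)
      (fun s hs => (memW_hasDerivWithinAt hf hs hξ).continuousWithinAt) fun s hs => ?_
    rw [interior_Icc] at hs
    rw [((memW_hasDerivWithinAt hf (Ioo_subset_Icc_self hs) hξ).hasDerivAt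
      (Icc_mem_nhds hs.1 hs.2)).deriv]
    exact hf.2.2.2.2.2.1 s (Ioo_subset_Icc_self hs) ξ hξ
  have h := hanti (Ico_subset_Icc_self hT) (right_mem_Icc.2 C.hT₀₂.le) hT.2
  simpa only [hf.2.2.1 ξ hξ] using h

lemma gapKernel_contDiffOn (hf : memW C f) {b : ℝ} (hb : b < C.Tc) :
    ContDiffOn ℝ 1 (fun p : ℝ × ℝ => gapKernel (f p.1 p.2) p.1 p.2)
      (Icc C.T₀ b ×ˢ Icc C.eps C.om) := by
  have hfc : ContDiffOn ℝ 1 (fun p : ℝ × ℝ => f p.1 p.2) (Icc C.T₀ b ×ˢ Icc C.eps C.om) :=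
    (hf.1.of_le one_le_two).mono (prod_mono (Icc_subset_Icc_right hb.le) Subset.rfl)
  have hfpos : ∀ p ∈ Icc C.T₀ b ×ˢ Icc C.eps C.om, 0 < f p.1 p.2 := fun p hp =>
    memW_pos hf ⟨hp.1.1, hp.1.2.trans_lt hb⟩ hp.2
  have hden : ContDiffOn ℝ 1 (fun p : ℝ × ℝ => p.2 ^ 2 + f p.1 p.2)
      (Icc C.T₀ b ×ˢ Icc C.eps C.om) := (contDiff_snd.pow 2).contDiffOn.add hfc
  have hdpos : ∀ p ∈ Icc C.T₀ b ×ˢ Icc C.eps C.om, 0 < p.2 ^ 2 + f p.1 p.2 := fun p hp =>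
    add_pos_of_nonneg_of_pos (sq_nonneg _) (hfpos p hp)
  refine ((hfc.div hden fun p hp => (hdpos p hp).ne').sqrt
    fun p hp => (div_pos (hfpos p hp) (hdpos p hp)).ne').mul (contDiff_tanh.comp_contDiffOn
    ((hden.sqrt fun p hp => (hdpos p hp).ne').div
      (contDiff_const.mul contDiff_fst).contDiffOn fun p hp => ?_))
  have : 0 < p.1 := C.T₀_pos.trans_le hp.1.1
  positivity

lemma integral_gapKernel_pos (hf : memW C f) {T x : ℝ} (hT : T ∈ Ico C.T₀ C.Tc)
    (hx : x ∈ C.Iset) : 0 < ∫ ξ in C.eps..C.om, C.U x ξ * gapKernel (f T ξ) T ξ := by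
  have hcont := (gapKernel_contDiffOn hf hT.2).continuousOn.section_snd (right_mem_Icc.2 hT.1)
  refine intervalIntegral.intervalIntegral_pos_of_pos_on
    (((potential_continuousOn hx).mul hcont).intervalIntegrable_of_Icc C.hepsom.le)
    (fun ξ hξ => mul_pos (potential_pos hx (Ioo_subset_Icc_self hξ)) ?_) C.hepsom
  have hfp := memW_pos hf hT (Ioo_subset_Icc_self hξ)
  have hTp : 0 < T := C.T₀_pos.trans_le hT.1
  have hξp : 0 < ξ := C.heps.trans hξ.1
  refine mul_pos (Real.sqrt_pos.2 (by positivity)) (tanh_pos (by positivity))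

lemma pderivT_opA_neg_of_lt (hf : memW C f) {T x : ℝ} (hT : T ∈ Ico C.T₀ C.Tc)
    (hx : x ∈ C.Iset) : pderivT C (opA C f) T x < 0 := by
  obtain ⟨b, hTb, hb⟩ := exists_between hT.2
  have hab : C.T₀ < b := hT.1.trans_lt hTb
  have hTb' : T ∈ Icc C.T₀ b := ⟨hT.1, hTb.le⟩
  have hG := gapKernel_contDiffOn hf hb
  have hI := hasDerivWithinAt_integral_mul hab C.hepsom (potential_continuousOn hx) hG hTb'
  have hnhds : Icc C.T₀ b ∈ 𝓝[Icc C.T₀ C.Tc] T := by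
    filter_upwards [self_mem_nhdsWithin, mem_nhdsWithin_of_mem_nhds (Iio_mem_nhds hTb)]
      with s hs hs' using ⟨hs.1, le_of_lt hs'⟩
  have hA := (hI.mono_of_mem_nhdsWithin hnhds).pow 2
  replace hA := hA.congr_of_mem (fun s _ => opA_eq C f s x) (Ico_subset_Icc_self hT)
  rw [pderivT, hA.derivWithin (uniqueDiffOn_Icc C.hT₀₂ T (Ico_subset_Icc_self hT))]
  have hpos := integral_gapKernel_pos hf hT hx
  have hneg : 0 < ∫ ξ in C.eps..C.om, -(C.U x ξ * fderivWithin ℝ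
      (fun p : ℝ × ℝ => gapKernel (f p.1 p.2) p.1 p.2) (Icc C.T₀ b ×ˢ Icc C.eps C.om)
      (T, ξ) (1, 0)) := by
    refine intervalIntegral.intervalIntegral_pos_of_pos_on
      (((potential_continuousOn hx).mul ((continuousOn_partial_fst hab C.hepsom
        hG).section_snd hTb')).neg.intervalIntegrable_of_Icc C.hepsom.le)
      (fun ξ hξ => ?_) C.hepsom
    have hξ' := Ioo_subset_Icc_self hξ
    have hlt := gapKernel_deriv_neg (φ := fun s => f s ξ) (uniqueDiffOn_Icc hab T hTb')
      (C.heps.trans hξ.1)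
      (C.T₀_pos.trans_le hT.1) (memW_pos hf hT hξ')
      (hf.2.2.2.2.2.1 T (Ico_subset_Icc_self hT) ξ hξ')
      ((memW_hasDerivWithinAt hf (Ico_subset_Icc_self hT) hξ').mono
        (Icc_subset_Icc_right hb.le)) (hasDerivWithinAt_partial_fst hG hTb' hξ')
    nlinarith [mul_neg_of_pos_of_neg (potential_pos hx hξ') hlt]
  rw [intervalIntegral.integral_neg] at hneg
  have := mul_pos hpos hneg
  simp only [Nat.cast_ofNat, Nat.add_one_sub_one, pow_one]
  nlinarith

lemma tendsto_div_of_memW (hf : memW C f) {ξ : ℝ} (hξ : ξ ∈ C.Iset) :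
    Tendsto (fun T => f T ξ / (C.Tc - T)) (𝓝[Icc C.T₀ C.Tc \ {C.Tc}] C.Tc)
      (𝓝 (-pderivT C f C.Tc ξ)) := by
  refine (hasDerivWithinAt_iff_tendsto_slope.1
    (memW_hasDerivWithinAt hf (right_mem_Icc.2 C.hT₀₂.le) hξ)).neg.congr fun T => ?_
  rw [slope_def_field, hf.2.2.1 ξ hξ, ← div_neg, neg_sub, sub_zero]

lemma div_le_of_memW (hf : memW C f) {T ξ : ℝ} (hT : T ∈ Ico C.T₀ C.Tc) (hξ : ξ ∈ C.Iset) :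
    f T ξ / (C.Tc - T) ≤ C.MT := by
  have h := (convex_Icc C.T₀ C.Tc).norm_image_sub_le_of_norm_hasDerivWithin_le
    (f := fun s => f s ξ) (f' := fun s => pderivT C f s ξ) (C := C.MT)
    (fun s hs => memW_hasDerivWithinAt hf hs hξ)
    (fun s hs => by
      rw [Real.norm_of_nonpos (hf.2.2.2.2.2.1 s hs ξ hξ).le]
      exact hf.2.2.2.2.2.2 s hs ξ hξ)
    (right_mem_Icc.2 C.hT₀₂.le) (Ico_subset_Icc_self hT)
  rw [div_le_iff₀ (sub_pos.2 hT.2)]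
  simp only [hf.2.2.1 ξ hξ, sub_zero] at h
  rw [Real.norm_of_nonpos (sub_neg.2 hT.2).le, neg_sub] at h
  exact (le_abs_self _).trans h

/-- The limit of `gapKernel (f T ξ) T ξ / √(T_c - T)` as `T` tends to `T_c`. -/
def criticalKernel (C : BCSContext) (f : ℝ → ℝ → ℝ) (ξ : ℝ) : ℝ :=
  Real.sqrt (-pderivT C f C.Tc ξ / ξ ^ 2) * Real.tanh (ξ / (2 * C.Tc))

lemma integral_criticalKernel_pos (hf : memW C f) {x : ℝ} (hx : x ∈ C.Iset) :
    0 < ∫ ξ in C.eps..C.om, C.U x ξ * criticalKernel C f ξ := by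
  have hTc := right_mem_Icc.2 C.hT₀₂.le
  refine intervalIntegral.intervalIntegral_pos_of_pos_on
    (((potential_continuousOn hx).mul (ContinuousOn.mul ?_ ?_)).intervalIntegrable_of_Icc
      C.hepsom.le)
    (fun ξ hξ => mul_pos (potential_pos hx (Ioo_subset_Icc_self hξ)) ?_) C.hepsom
  · refine ((continuousOn_pderivT hf hTc).neg.div (by fun_prop) fun ξ hξ => ?_).sqrt
    exact (pow_pos (C.heps.trans_le hξ.1) 2).ne'
  · exact ((contDiff_tanh (n := 1)).continuous.comp (by fun_prop)).continuousOn
  · have hξp : 0 < ξ := C.heps.trans hξ.1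
    have hTp : 0 < C.Tc := C.T₀_pos.trans C.hT₀₂
    have hp := neg_pos.2 (hf.2.2.2.2.2.1 C.Tc hTc ξ (Ioo_subset_Icc_self hξ))
    exact mul_pos (Real.sqrt_pos.2 (by positivity)) (tanh_pos (by positivity))

lemma gapKernel_div_sqrt {y T ξ r : ℝ} (hr : 0 < r) :
    gapKernel y T ξ / Real.sqrt r = Real.sqrt (y / r / (ξ ^ 2 + y)) *
      Real.tanh (Real.sqrt (ξ ^ 2 + y) / (2 * T)) := by
  rw [gapKernel, mul_div_right_comm, ← Real.sqrt_div' _ hr.le, div_right_comm]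

lemma tendsto_integral_gapKernel_div (hf : memW C f) {x : ℝ} (hx : x ∈ C.Iset) :
    Tendsto (fun T => (∫ ξ in C.eps..C.om, C.U x ξ * gapKernel (f T ξ) T ξ) /
        Real.sqrt (C.Tc - T)) (𝓝[Icc C.T₀ C.Tc \ {C.Tc}] C.Tc)
      (𝓝 (∫ ξ in C.eps..C.om, C.U x ξ * criticalKernel C f ξ)) := by
  have hmem : ∀ᶠ T in 𝓝[Icc C.T₀ C.Tc \ {C.Tc}] C.Tc, T ∈ Ico C.T₀ C.Tc := by
    filter_upwards [self_mem_nhdsWithin] with T hT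
    exact ⟨hT.1.1, lt_of_le_of_ne hT.1.2 hT.2⟩
  have hsub : uIoc C.eps C.om ⊆ Icc C.eps C.om := by
    rw [uIoc_of_le C.hepsom.le]; exact Ioc_subset_Icc_self
  simp only [← intervalIntegral.integral_div, mul_div_assoc]
  refine intervalIntegral.tendsto_integral_filter_of_dominated_convergence
    (fun _ => C.U₂ * Real.sqrt (C.MT / C.eps ^ 2)) ?_ ?_ intervalIntegrable_const ?_
  · filter_upwards [hmem] with T hT
    refine ContinuousOn.aestronglyMeasurable (ContinuousOn.mono ?_ hsub) measurableSet_uIoc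
    exact (potential_continuousOn hx).mul (((gapKernel_contDiffOn hf
      hT.2).continuousOn.section_snd (right_mem_Icc.2 hT.1)).div_const _)
  · filter_upwards [hmem] with T hT
    refine Eventually.of_forall fun ξ hξ => ?_
    have hξ' := hsub hξ
    have hfp := memW_pos hf hT hξ'
    have hr : 0 < C.Tc - T := sub_pos.2 hT.2
    rw [gapKernel_div_sqrt hr, norm_mul, norm_mul,
      Real.norm_of_nonneg (potential_pos hx hξ').le, Real.norm_of_nonneg (Real.sqrt_nonneg _)]
    refine mul_le_mul (C.hUub x hx ξ hξ') ?_ (by positivity) (C.hU₁pos.le.trans C.hU₁₂)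
    refine (mul_le_of_le_one_right (Real.sqrt_nonneg _) (Real.abs_tanh_lt_one _).le).trans ?_
    have hle := div_le_of_memW hf hT hξ'
    refine Real.sqrt_le_sqrt (div_le_div₀ ((div_pos hfp hr).le.trans hle) hle
      (pow_pos C.heps 2) ?_)
    nlinarith [pow_le_pow_left₀ C.heps.le hξ'.1 2]
  · refine Eventually.of_forall fun ξ hξ => ?_
    have hξ' := hsub hξ
    have hξp : 0 < ξ := C.heps.trans_le hξ'.1
    have hTp : 0 < C.Tc := C.T₀_pos.trans C.hT₀₂
    have hf0 : Tendsto (fun T => ξ ^ 2 + f T ξ) (𝓝[Icc C.T₀ C.Tc \ {C.Tc}] C.Tc)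
        (𝓝 (ξ ^ 2)) := by
      have h := (((memW_hasDerivWithinAt hf (right_mem_Icc.2 C.hT₀₂.le)
        hξ').continuousWithinAt).mono (sdiff_subset (t := {C.Tc}))).tendsto
      simpa [hf.2.2.1 ξ hξ'] using h.const_add (ξ ^ 2)
    have hT : Tendsto (fun T : ℝ => 2 * T) (𝓝[Icc C.T₀ C.Tc \ {C.Tc}] C.Tc)
        (𝓝 (2 * C.Tc)) := (tendsto_id.mono_left nhdsWithin_le_nhds).const_mul 2
    have hth := (((contDiff_tanh (n := 1)).continuous.tendsto _).comp
      (hf0.sqrt.div hT (by positivity)))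
    rw [Real.sqrt_sq hξp.le] at hth
    refine ((((tendsto_div_of_memW hf hξ').div hf0 (by positivity)).sqrt.mul
      hth).const_mul (C.U x ξ)).congr' ?_
    filter_upwards [hmem] with T hT
    rw [gapKernel_div_sqrt (sub_pos.2 hT.2)]
    rfl

lemma pderivT_opA_neg_critical (hf : memW C f) {x : ℝ} (hx : x ∈ C.Iset) :
    pderivT C (opA C f) C.Tc x < 0 := by
  have hTc := right_mem_Icc.2 C.hT₀₂.le
  have hzero : opA C f C.Tc x = 0 := by
    rw [opA_eq, sq_eq_zero_iff]
    refine (intervalIntegral.integral_congr (g := fun _ => 0) fun ξ hξ => ?_).trans (by simp)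
    rw [uIcc_of_le C.hepsom.le] at hξ
    simp [gapKernel, hf.2.2.1 ξ hξ]
  have hA : HasDerivWithinAt (fun s => opA C f s x)
      (-(∫ ξ in C.eps..C.om, C.U x ξ * criticalKernel C f ξ) ^ 2) (Icc C.T₀ C.Tc) C.Tc := by
    rw [hasDerivWithinAt_iff_tendsto_slope]
    refine ((tendsto_integral_gapKernel_div hf hx).pow 2).neg.congr' ?_
    filter_upwards [self_mem_nhdsWithin] with T hT
    rw [slope_def_field, hzero, opA_eq, div_pow, Real.sq_sqrt (sub_nonneg.2 hT.1.2), sub_zero,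
      ← div_neg, neg_sub]
  rw [pderivT, hA.derivWithin (uniqueDiffOn_Icc C.hT₀₂ C.Tc hTc), neg_lt_zero]
  exact pow_pos (integral_criticalKernel_pos hf hx) 2

end BCSContext

theorem stmt_10 (C : BCSContext) (f : ℝ → ℝ → ℝ) (hf : memW C f) :
    ∀ T ∈ Icc C.T₀ C.Tc, ∀ x ∈ C.Iset, 0 < -(pderivT C (opA C f) T x) := by
  intro T hT x hx
  rw [neg_pos]
  rcases hT.2.lt_or_eq with h | rfl
  · exact BCSContext.pderivT_opA_neg_of_lt hf ⟨hT.1, h⟩ hx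
  · exact BCSContext.pderivT_opA_neg_critical hf hx

end
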